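/- Let c ~ N(0, σ₀²) and, conditionally on c, let x_1, ..., x_M be i.i.d. N(c, σ²). Then for any α ∈ {1,...,M}, the mutual information between x_α and the remaining views {x_β : β ≠ α} equals (1/2) log[(1 + σ₀²/σ²)(1 - σ₀²/(σ² + M σ₀²))]. -/

import Mathlib

open MeasureTheory ProbabilityTheory

/-- Kullback–Leibler divergence `KL(μ ‖ ν) = ∫ log (dμ/dν) dμ`. -/
noncomputable def klDiv' {α : Type*} [MeasurableSpace α] (μ ν : Measure α) : ℝ :=
  ∫ x, Real.log (μ.rnDeriv ν x).toReal ∂μ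

open scoped NNReal ENNReal

theorem mi_gauss_wd (c : ℝ) {v : ℝ≥0} (hv : v ≠ 0) :
    gaussianReal c v = (gaussianReal 0 v).withDensity
      (fun x => ENNReal.ofReal (Real.exp ((c * x - c ^ 2 / 2) / v))) := by
  have hv' : (0:ℝ) < v := by positivity
  rw [gaussianReal_of_var_ne_zero _ hv, gaussianReal_of_var_ne_zero _ hv,
    ← withDensity_mul _ (measurable_gaussianPDF _ _) (by fun_prop)]
  congr 1
  ext x
  rw [Pi.mul_apply, gaussianPDF_def, gaussianPDF_def, ← ENNReal.ofReal_mul (gaussianPDFReal_nonneg _ _ _),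
    gaussianPDFReal_def, gaussianPDFReal_def]
  simp only []
  rw [mul_assoc (√(2 * Real.pi * v))⁻¹, ← Real.exp_add]
  congr 3
  field_simp
  ring

theorem mi_lintegral_prod {ι : Type*} [Fintype ι] (P : ι → Measure ℝ) [∀ i, IsProbabilityMeasure (P i)]
    (f : ι → ℝ → ℝ≥0∞) (hf : ∀ i, Measurable (f i)) :
    ∫⁻ x, ∏ i, f i (x i) ∂(Measure.pi P) = ∏ i, ∫⁻ y, f i y ∂(P i) := by
  have h := iIndepFun_pi (μ := P) (X := f) (fun i => (hf i).aemeasurable)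
  have := lintegral_prod_eq_prod_lintegral_of_indepFun Finset.univ (fun i (x : ι → ℝ) => f i (x i)) h
    (fun i => (hf i).comp (measurable_pi_apply i))
  rw [this]
  refine Finset.prod_congr rfl fun i _ => ?_
  conv_rhs => rw [← (measurePreserving_eval P i).map_eq]
  rw [lintegral_map (hf i) (measurable_pi_apply i)]

theorem mi_pi_wd {ι : Type*} [Fintype ι] (c : ℝ) {v : ℝ≥0} (hv : v ≠ 0) :
    Measure.pi (fun _ : ι => gaussianReal c v) = (Measure.pi (fun _ : ι => gaussianReal 0 v)).withDensity
      (fun x => ENNReal.ofReal (Real.exp ((c * (∑ i, x i) - (Fintype.card ι : ℕ) * c ^ 2 / 2) / v))) := by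
  refine Measure.pi_eq fun s hs => ?_
  rw [withDensity_apply _ (MeasurableSet.univ_pi hs), ← lintegral_indicator (MeasurableSet.univ_pi hs)]
  have : ∀ i, gaussianReal c v (s i) = ∫⁻ y, (s i).indicator
      (fun x => ENNReal.ofReal (Real.exp ((c * x - c ^ 2 / 2) / v))) y ∂(gaussianReal 0 v) := by
    intro i
    rw [lintegral_indicator (hs i), ← withDensity_apply _ (hs i), ← mi_gauss_wd c hv]
  simp_rw [this]
  rw [← mi_lintegral_prod]
  · congr 1
    ext x
    by_cases hx : x ∈ Set.univ.pi s
    · rw [Set.indicator_of_mem hx]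
      rw [Finset.prod_congr rfl (fun i _ => Set.indicator_of_mem (hx i trivial) _),
        ← ENNReal.ofReal_prod_of_nonneg (fun _ _ => (Real.exp_pos _).le), ← Real.exp_sum]
      congr 2
      rw [← Finset.sum_div, Finset.sum_sub_distrib, ← Finset.mul_sum]
      simp
      ring
    · rw [Set.indicator_of_notMem hx]
      simp only [Set.mem_pi, not_forall] at hx
      obtain ⟨i, -, hi⟩ := hx
      exact (Finset.prod_eq_zero (Finset.mem_univ i) (Set.indicator_of_notMem hi _)).symm
  · intro i
    exact Measurable.indicator (by fun_prop) (hs i)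

noncomputable def miG (n : ℕ) (v s : ℝ≥0) (t : ℝ) : ℝ :=
  √(v / (v + n * s)) * Real.exp (s * t ^ 2 / (2 * v * (v + n * s)))

theorem mi_lint (n : ℕ) {v s : ℝ≥0} (hv : v ≠ 0) (hs : s ≠ 0) (t : ℝ) :
    ∫⁻ c, ENNReal.ofReal (Real.exp ((c * t - n * c ^ 2 / 2) / v)) ∂(gaussianReal 0 s)
      = ENNReal.ofReal (miG n v s t) := by
  have hv' : (0:ℝ) < v := by positivity
  have hs' : (0:ℝ) < s := by positivity
  set w : ℝ≥0 := s * v / (v + n * s) with hw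
  have hw0 : w ≠ 0 := by positivity
  have hw' : (w:ℝ) = s * v / (v + n * s) := by rw [hw]; push_cast; rfl
  rw [gaussianReal_of_var_ne_zero _ hs,
    lintegral_withDensity_eq_lintegral_mul _ (measurable_gaussianPDF _ _) (by fun_prop)]
  have key : ∀ c, (gaussianPDF 0 s * fun c => ENNReal.ofReal (Real.exp ((c * t - n * c ^ 2 / 2) / v))) c
      = ENNReal.ofReal (miG n v s t) * gaussianPDF (s * t / (v + n * s)) w c := by
    intro c
    rw [Pi.mul_apply, gaussianPDF_def, gaussianPDF_def, ← ENNReal.ofReal_mul (gaussianPDFReal_nonneg _ _ _),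
      ← ENNReal.ofReal_mul (by unfold miG; positivity)]
    congr 1
    rw [gaussianPDFReal_def, gaussianPDFReal_def]
    simp only [miG]
    rw [mul_assoc, ← Real.exp_add, mul_mul_mul_comm, ← Real.exp_add]
    congr 1
    · rw [← Real.sqrt_inv, ← Real.sqrt_inv, ← Real.sqrt_mul (by positivity)]
      congr 1
      rw [hw']
      field_simp
    · congr 1
      rw [hw']
      field_simp
      ring
  simp_rw [key]
  rw [lintegral_const_mul _ (measurable_gaussianPDF _ _), lintegral_gaussianPDF_eq_one _ hw0, mul_one]

theorem mi_gauss_G (n : ℕ) (hn : n ≠ 0) {v s : ℝ≥0} (hv : v ≠ 0) (hs : s ≠ 0) :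
    (gaussianReal 0 (n * v)).withDensity (fun t => ENNReal.ofReal (miG n v s t))
      = gaussianReal 0 (n * (v + n * s)) := by
  have hv' : (0:ℝ) < v := by positivity
  have hs' : (0:ℝ) < s := by positivity
  have hn' : (0:ℝ) < n := by positivity
  have hm : Measurable (miG n v s) := by unfold miG; fun_prop
  rw [gaussianReal_of_var_ne_zero _ (by positivity), gaussianReal_of_var_ne_zero _ (by positivity),
    ← withDensity_mul _ (measurable_gaussianPDF _ _) (by fun_prop)]
  congr 1
  ext x
  rw [Pi.mul_apply, gaussianPDF_def, gaussianPDF_def, ← ENNReal.ofReal_mul (gaussianPDFReal_nonneg _ _ _)]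
  congr 1
  rw [gaussianPDFReal_def, gaussianPDFReal_def]
  simp only [miG]
  rw [mul_mul_mul_comm, ← Real.exp_add]
  congr 1
  · rw [← Real.sqrt_inv, ← Real.sqrt_inv, ← Real.sqrt_mul (by positivity)]
    congr 1
    push_cast
    field_simp
  · congr 1
    push_cast
    field_simp
    ring

theorem mi_law {E : Type*} [MeasurableSpace E] (P : Measure E) [IsProbabilityMeasure P] (T : E → ℝ)
    (hT : Measurable T) (n : ℕ) {v : ℝ≥0} (hv : v ≠ 0) (κ : ℝ → Measure E)
    (hκp : ∀ c, IsProbabilityMeasure (κ c))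
    (hκ : ∀ c, κ c = P.withDensity
      (fun x => ENNReal.ofReal (Real.exp ((c * T x - n * c ^ 2 / 2) / v)))) :
    P.map T = gaussianReal 0 (n * v) := by
  have hv' : (0:ℝ) < v := by positivity
  have hm : mgf T P = mgf id (gaussianReal 0 (n * v)) := by
    ext t
    rw [mgf_id_gaussianReal]
    have h1 : (κ (t * v)) Set.univ = 1 := measure_univ
    rw [hκ, withDensity_apply _ MeasurableSet.univ, Measure.restrict_univ] at h1
    have h2 : ∫ x, Real.exp ((t * v * T x - n * (t * v) ^ 2 / 2) / v) ∂P = 1 := by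
      rw [integral_eq_lintegral_of_nonneg_ae (Filter.Eventually.of_forall fun _ => (Real.exp_pos _).le)
        (by fun_prop), h1]
      simp
    have h3 : ∀ x, Real.exp ((t * v * T x - n * (t * v) ^ 2 / 2) / v)
        = Real.exp (- (n * v * t ^ 2 / 2)) * Real.exp (t * T x) := by
      intro x
      rw [← Real.exp_add]
      congr 1
      field_simp
      ring
    simp_rw [h3] at h2
    rw [integral_const_mul, Real.exp_neg, inv_mul_eq_one₀ (Real.exp_pos _).ne'] at h2
    simp only [mgf]
    rw [← h2]
    push_cast
    simp
  have hc : complexMGF T P = complexMGF id (gaussianReal 0 (n * v)) := by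
    ext z
    refine eqOn_complexMGF_of_mgf hm ?_
    rw [integrableExpSet_eq_of_mgf hm, integrableExpSet_id_gaussianReal]
    simp
  simpa using Measure.ext_of_complexMGF_eq hT.aemeasurable aemeasurable_id hc

theorem mi_meas {E : Type*} [MeasurableSpace E] (P : Measure E) [IsProbabilityMeasure P] (T : E → ℝ)
    (hT : Measurable T) (n : ℕ) {v : ℝ≥0} (κ : ℝ → Measure E)
    (hκ : ∀ c, κ c = P.withDensity
      (fun x => ENNReal.ofReal (Real.exp ((c * T x - n * c ^ 2 / 2) / v)))) :
    Measurable κ := by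
  refine Measure.measurable_of_measurable_coe _ fun A hA => ?_
  have : ∀ c, κ c A = ∫⁻ x in A, ENNReal.ofReal (Real.exp ((c * T x - n * c ^ 2 / 2) / v)) ∂P := by
    intro c
    rw [hκ, withDensity_apply _ hA]
  simp_rw [this]
  refine Measurable.lintegral_prod_right' (ν := P.restrict A)
    (f := fun p : ℝ × E => ENNReal.ofReal (Real.exp ((p.1 * T p.2 - n * p.1 ^ 2 / 2) / v))) ?_
  fun_prop

theorem mi_mix {E : Type*} [MeasurableSpace E] (P : Measure E) [IsProbabilityMeasure P] (T : E → ℝ)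
    (hT : Measurable T) (n : ℕ) {v s : ℝ≥0} (hv : v ≠ 0) (hs : s ≠ 0) (κ : ℝ → Measure E)
    (hκ : ∀ c, κ c = P.withDensity
      (fun x => ENNReal.ofReal (Real.exp ((c * T x - n * c ^ 2 / 2) / v)))) :
    (gaussianReal 0 s).bind κ = P.withDensity (fun x => ENNReal.ofReal (miG n v s (T x))) := by
  ext A hA
  rw [Measure.bind_apply hA (mi_meas P T hT n κ hκ).aemeasurable, withDensity_apply _ hA]
  simp_rw [← mi_lint n hv hs, hκ, withDensity_apply _ hA]
  refine lintegral_lintegral_swap ?_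
  fun_prop

theorem mi_moment {E : Type*} [MeasurableSpace E] (P : Measure E) [IsProbabilityMeasure P] (T : E → ℝ)
    (hT : Measurable T) (n : ℕ) (hn : n ≠ 0) {v s : ℝ≥0} (hv : v ≠ 0) (hs : s ≠ 0)
    (κ : ℝ → Measure E) (hκp : ∀ c, IsProbabilityMeasure (κ c))
    (hκ : ∀ c, κ c = P.withDensity
      (fun x => ENNReal.ofReal (Real.exp ((c * T x - n * c ^ 2 / 2) / v)))) :
    Integrable (fun x => T x ^ 2) ((gaussianReal 0 s).bind κ) ∧
    ∫ x, T x ^ 2 ∂((gaussianReal 0 s).bind κ) = n * (v + n * s) := by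
  have hmG : Measurable (miG n v s) := by unfold miG; fun_prop
  have hmap : ((gaussianReal 0 s).bind κ).map T = gaussianReal 0 (n * (v + n * s)) := by
    rw [mi_mix P T hT n hv hs κ hκ, ← mi_gauss_G n hn hv hs, ← mi_law P T hT n hv κ hκp hκ]
    ext A hA
    rw [Measure.map_apply hT hA, withDensity_apply _ (hT hA), withDensity_apply _ hA,
      setLIntegral_map hA (by fun_prop) hT]
  have hL := memLp_id_gaussianReal' (μ := 0) (v := n * (v + n * s)) 2 (by simp)
  constructor
  · have h2 := hL.integrable_sq
    rw [← hmap] at h2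
    exact h2.comp_measurable hT
  · have h3 : ∫ y, y ^ 2 ∂(((gaussianReal 0 s).bind κ).map T) = n * (v + n * s) := by
      rw [hmap]
      have h4 := variance_eq_sub hL
      rw [variance_id_gaussianReal] at h4
      simp at h4
      exact h4.symm
    rw [← h3, integral_map hT.aemeasurable (by fun_prop)]

theorem mi_split {M : ℕ} (α : Fin M) (ρ : Measure ℝ) [IsProbabilityMeasure ρ] :
    (Measure.pi (fun _ : Fin M => ρ)).map
      (fun x => ((x α, fun β => x β.1) : ℝ × ({β : Fin M // β ≠ α} → ℝ)))
      = ρ.prod (Measure.pi (fun _ : {β : Fin M // β ≠ α} => ρ)) := by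
  let g : ℝ × ({β : Fin M // β ≠ α} → ℝ) → (Fin M → ℝ) :=
    fun p i => if h : i = α then p.1 else p.2 ⟨i, h⟩
  have hg : Measurable g := by
    refine measurable_pi_lambda _ fun i => ?_
    by_cases h : i = α
    · simp only [g, h, dite_true]; fun_prop
    · simp only [g, h, dite_false]; fun_prop
  have h1 : Measure.pi (fun _ : Fin M => ρ)
      = (ρ.prod (Measure.pi (fun _ : {β : Fin M // β ≠ α} => ρ))).map g := by
    refine Measure.pi_eq fun s hs => ?_
    rw [Measure.map_apply hg (MeasurableSet.univ_pi hs)]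
    have : g ⁻¹' (Set.univ.pi s) = s α ×ˢ Set.univ.pi (fun β : {β : Fin M // β ≠ α} => s β.1) := by
      ext p
      simp only [Set.mem_preimage, Set.mem_pi, Set.mem_univ, true_imp_iff, Set.mem_prod, g]
      constructor
      · intro h
        refine ⟨by simpa using h α, fun β => by simpa [β.2] using h β.1⟩
      · rintro ⟨h, h'⟩ i
        by_cases hi : i = α
        · subst hi; simpa using h
        · simpa [hi] using h' ⟨i, hi⟩
    rw [this, Measure.prod_prod, Measure.pi_pi, Fintype.prod_eq_mul_prod_subtype_ne _ α]
  rw [h1, Measure.map_map (by fun_prop) hg]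
  convert Measure.map_id
  ext p
  · simp [g]
  · rename_i β
    simp [g, β.2]

theorem mi_map_bind {E F : Type*} [MeasurableSpace E] [MeasurableSpace F] (m : Measure ℝ)
    (κ : ℝ → Measure E) (hκ : Measurable κ) (f : E → F) (hf : Measurable f) :
    (m.bind κ).map f = m.bind (fun c => (κ c).map f) := by
  ext A hA
  have h : Measurable (fun c => (κ c).map f) := (Measure.measurable_map f hf).comp hκ
  rw [Measure.map_apply hf hA, Measure.bind_apply (hf hA) hκ.aemeasurable,
    Measure.bind_apply hA h.aemeasurable]
  simp_rw [Measure.map_apply hf hA]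

theorem one_vs_rest_mi_gaussian (M : ℕ) (hM : 2 ≤ M) (σ σ₀ : ℝ)
    (hσ : 0 < σ) (hσ₀ : 0 < σ₀) (α : Fin M) :
    -- hierarchical model: c ~ N(0, σ₀²), views x_1, ..., x_M i.i.d. N(c, σ²) given c
    let μ : Measure (Fin M → ℝ) :=
      (gaussianReal 0 ((σ₀ ^ 2).toNNReal)).bind
        (fun c => Measure.pi (fun _ : Fin M => gaussianReal c ((σ ^ 2).toNNReal)))
    -- joint law of (x_α, rest)
    let joint : Measure (ℝ × ({β : Fin M // β ≠ α} → ℝ)) :=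
      μ.map (fun x => (x α, fun β => x β.1))
    klDiv' joint ((joint.map Prod.fst).prod (joint.map Prod.snd))
      = (1 / 2) * Real.log
          ((1 + σ₀ ^ 2 / σ ^ 2) * (1 - σ₀ ^ 2 / (σ ^ 2 + M * σ₀ ^ 2))) := by
  have hvr : (((σ ^ 2).toNNReal : ℝ≥0) : ℝ) = σ ^ 2 := Real.coe_toNNReal _ (by positivity)
  have hsr : (((σ₀ ^ 2).toNNReal : ℝ≥0) : ℝ) = σ₀ ^ 2 := Real.coe_toNNReal _ (by positivity)
  rw [← hvr, ← hsr, Real.toNNReal_coe, Real.toNNReal_coe]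
  have hv0 : (σ ^ 2).toNNReal ≠ 0 := by
    simp only [ne_eq, Real.toNNReal_eq_zero, not_le]; positivity
  have hs0 : (σ₀ ^ 2).toNNReal ≠ 0 := by
    simp only [ne_eq, Real.toNNReal_eq_zero, not_le]; positivity
  generalize (σ ^ 2).toNNReal = v at *
  generalize (σ₀ ^ 2).toNNReal = s at *
  intro μ joint
  have hv' : (0:ℝ) < v := by positivity
  have hs' : (0:ℝ) < s := by positivity
  obtain ⟨k, rfl⟩ : ∃ k, M = k + 1 := ⟨M - 1, by omega⟩
  have hk : k ≠ 0 := by omega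
  have hk' : (0:ℝ) < k := by positivity
  have hcard : Fintype.card {β : Fin (k + 1) // β ≠ α} = k := by
    simp
  -- the three kernels
  let κ₁ : ℝ → Measure ℝ := fun c => gaussianReal c v
  let κ₂ : ℝ → Measure ({β : Fin (k + 1) // β ≠ α} → ℝ) := fun c => Measure.pi (fun _ => gaussianReal c v)
  let κ₃ : ℝ → Measure (ℝ × ({β : Fin (k + 1) // β ≠ α} → ℝ)) := fun c => (κ₁ c).prod (κ₂ c)
  let S : ({β : Fin (k + 1) // β ≠ α} → ℝ) → ℝ := fun y => ∑ i, y i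
  have hS : Measurable S := by fun_prop
  have p₁ : ∀ c, IsProbabilityMeasure (κ₁ c) := fun c => by dsimp [κ₁]; infer_instance
  have p₂ : ∀ c, IsProbabilityMeasure (κ₂ c) := fun c => by dsimp [κ₂]; infer_instance
  have p₃ : ∀ c, IsProbabilityMeasure (κ₃ c) := fun c => by dsimp [κ₃]; infer_instance
  have h₁ : ∀ c, κ₁ c = (κ₁ 0).withDensity
      (fun x => ENNReal.ofReal (Real.exp ((c * x - (1:ℕ) * c ^ 2 / 2) / v))) := fun c => by
    simpa using mi_gauss_wd c hv0
  have h₂ : ∀ c, κ₂ c = (κ₂ 0).withDensity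
      (fun x => ENNReal.ofReal (Real.exp ((c * S x - k * c ^ 2 / 2) / v))) := fun c => by
    have := mi_pi_wd (ι := {β : Fin (k + 1) // β ≠ α}) c hv0
    rw [hcard] at this
    exact this
  have h₃ : ∀ c, κ₃ c = (κ₃ 0).withDensity
      (fun p => ENNReal.ofReal (Real.exp ((c * (p.1 + S p.2) - (k + 1 : ℕ) * c ^ 2 / 2) / v))) := by
    intro c
    change (κ₁ c).prod (κ₂ c) = ((κ₁ 0).prod (κ₂ 0)).withDensity _
    rw [h₁ c, h₂ c, prod_withDensity (by fun_prop) (by fun_prop)]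
    congr 1
    ext p
    rw [← ENNReal.ofReal_mul (Real.exp_pos _).le, ← Real.exp_add]
    congr 2
    push_cast
    ring
  have hT₃ : Measurable (fun p : ℝ × ({β : Fin (k + 1) // β ≠ α} → ℝ) => p.1 + S p.2) := by fun_prop
  have m₃ : Measurable κ₃ := mi_meas (κ₃ 0) _ hT₃ (k + 1) κ₃ h₃
  have hj : joint = (gaussianReal 0 s).bind κ₃ := by
    have hpi : Measurable (fun c => Measure.pi (fun _ : Fin (k + 1) => gaussianReal c v)) :=
      mi_meas (Measure.pi (fun _ : Fin (k + 1) => gaussianReal 0 v)) (fun x => ∑ i, x i)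
        (by fun_prop) (Fintype.card (Fin (k + 1))) _ (fun c => mi_pi_wd c hv0)
    simp only [joint, μ]
    rw [mi_map_bind _ _ hpi _ (by fun_prop)]
    congr 1
    ext1 c
    exact mi_split α (gaussianReal c v)
  have hj₁ : joint.map Prod.fst = (gaussianReal 0 s).bind κ₁ := by
    rw [hj, mi_map_bind _ _ m₃ _ measurable_fst]
    congr 1
    ext1 c
    simp [κ₃]
  have hj₂ : joint.map Prod.snd = (gaussianReal 0 s).bind κ₂ := by
    rw [hj, mi_map_bind _ _ m₃ _ measurable_snd]
    congr 1
    ext1 c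
    simp [κ₃]
  obtain ⟨i₃, e₃⟩ := mi_moment (κ₃ 0) _ hT₃ (k + 1) (by omega) hv0 hs0 κ₃ p₃ h₃
  obtain ⟨i₁, e₁⟩ := mi_moment (κ₁ 0) _ measurable_id 1 (by omega) hv0 hs0 κ₁ p₁ h₁
  obtain ⟨i₂, e₂⟩ := mi_moment (κ₂ 0) _ hS k hk hv0 hs0 κ₂ p₂ h₂
  rw [← hj] at i₃ e₃
  rw [← hj₁] at i₁ e₁
  rw [← hj₂] at i₂ e₂
  rw [integral_map (by fun_prop) (by fun_prop)] at e₁ e₂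
  replace i₁ := i₁.comp_measurable measurable_fst
  replace i₂ := i₂.comp_measurable measurable_snd
  have : IsProbabilityMeasure joint := by
    have hpm : IsProbabilityMeasure μ := by
      constructor
      simp only [μ]
      rw [Measure.bind_apply MeasurableSet.univ]
      · simp
      · exact (mi_meas (Measure.pi (fun _ : Fin (k + 1) => gaussianReal 0 v)) (fun x => ∑ i, x i)
          (by fun_prop) (Fintype.card (Fin (k + 1))) _ (fun c => mi_pi_wd c hv0)).aemeasurable
    exact Measure.isProbabilityMeasure_map (by fun_prop)
  have hG : ∀ n, Measurable (miG n v s) := fun n => by unfold miG; fun_prop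
  have hGpos : ∀ n t, 0 < miG n v s t := fun n t => by unfold miG; positivity
  set ν := (joint.map Prod.fst).prod (joint.map Prod.snd) with hν
  have hν' : ν = (κ₃ 0).withDensity
      (fun p => ENNReal.ofReal (miG 1 v s p.1 * miG k v s (S p.2))) := by
    rw [hν, hj₁, hj₂, mi_mix (κ₁ 0) _ measurable_id 1 hv0 hs0 κ₁ h₁, mi_mix (κ₂ 0) _ hS k hv0 hs0 κ₂ h₂,
      prod_withDensity (by fun_prop) (by fun_prop)]
    congr 1
    ext p
    rw [← ENNReal.ofReal_mul (hGpos _ _).le]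
    rfl
  let r : ℝ × ({β : Fin (k + 1) // β ≠ α} → ℝ) → ℝ := fun p =>
    miG (k + 1) v s (p.1 + S p.2) / (miG 1 v s p.1 * miG k v s (S p.2))
  have hr : Measurable r := by fun_prop
  have hjν : joint = ν.withDensity (fun p => ENNReal.ofReal (r p)) := by
    rw [hν', ← withDensity_mul _ (by fun_prop) (by fun_prop), hj,
      mi_mix (κ₃ 0) _ hT₃ (k + 1) hv0 hs0 κ₃ h₃]
    congr 1
    ext p
    rw [Pi.mul_apply, ← ENNReal.ofReal_mul (mul_pos (hGpos _ _) (hGpos _ _)).le]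
    congr 1
    rw [mul_div_cancel₀]
    exact (mul_pos (hGpos _ _) (hGpos _ _)).ne'
  have hprob1 : IsProbabilityMeasure (joint.map Prod.fst) := Measure.isProbabilityMeasure_map (by fun_prop)
  have hprob2 : IsProbabilityMeasure (joint.map Prod.snd) := Measure.isProbabilityMeasure_map (by fun_prop)
  have hac : joint ≪ ν := by rw [hjν]; exact withDensity_absolutelyContinuous _ _
  have hrn : joint.rnDeriv ν =ᵐ[joint] fun p => ENNReal.ofReal (r p) := by
    refine hac.ae_le ?_
    have := Measure.rnDeriv_withDensity ν (f := fun p => ENNReal.ofReal (r p)) (by fun_prop)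
    rwa [← hjν] at this
  let C : ℝ := (1 / 2) * Real.log ((1 + (s:ℝ) / v) * (1 - s / (v + (k + 1 : ℕ) * s)))
  have hone : (1:ℝ) - s / (v + (k + 1 : ℕ) * s) = (v + k * s) / (v + (k + 1 : ℕ) * s) := by
    push_cast
    field_simp
    ring
  have hlogG : ∀ (n : ℕ) t, Real.log (miG n v s t)
      = 1 / 2 * (Real.log v - Real.log (v + n * s)) + s / (2 * v * (v + n * s)) * t ^ 2 := by
    intro n t
    unfold miG
    rw [Real.log_mul (by positivity) (by positivity), Real.log_exp, Real.log_sqrt (by positivity),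
      Real.log_div (by positivity) (by positivity)]
    ring
  have hC : C = 1 / 2 * (Real.log v - Real.log (v + (k + 1 : ℕ) * s))
      - 1 / 2 * (Real.log v - Real.log (v + (1 : ℕ) * s))
      - 1 / 2 * (Real.log v - Real.log (v + k * s)) := by
    have h1 : (1:ℝ) + s / v = (v + (1:ℕ) * s) / v := by field_simp; simp
    simp only [C]
    rw [hone, h1, Real.log_mul (by positivity) (by positivity), Real.log_div (by positivity) (by positivity),
      Real.log_div (by positivity) (by positivity)]
    ring
  have hlog : ∀ p, Real.log (r p) = C + (s / (2 * v * (v + (k + 1 : ℕ) * s)) * (p.1 + S p.2) ^ 2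
      - s / (2 * v * (v + (1 : ℕ) * s)) * p.1 ^ 2 - s / (2 * v * (v + k * s)) * (S p.2) ^ 2) := by
    intro p
    simp only [r]
    rw [Real.log_div (hGpos _ _).ne' (mul_pos (hGpos _ _) (hGpos _ _)).ne',
      Real.log_mul (hGpos _ _).ne' (hGpos _ _).ne', hlogG, hlogG, hlogG, hC]
    ring
  have hfin : klDiv' joint ν = C := by
    clear_value C
    unfold klDiv'
    have : ∫ x, Real.log (joint.rnDeriv ν x).toReal ∂joint = ∫ x, Real.log (r x) ∂joint := by
      refine integral_congr_ae ?_
      filter_upwards [hrn] with p hp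
      rw [hp, ENNReal.toReal_ofReal]
      exact (div_pos (hGpos _ _) (mul_pos (hGpos _ _) (hGpos _ _))).le
    rw [this]
    simp_rw [hlog]
    have j₁ : Integrable (fun p => (s:ℝ) / (2 * v * (v + (1 : ℕ) * s)) * p.1 ^ 2) joint := i₁.const_mul _
    have j₂ : Integrable (fun p => (s:ℝ) / (2 * v * (v + k * s)) * (S p.2) ^ 2) joint := i₂.const_mul _
    have j₃ : Integrable (fun p => (s:ℝ) / (2 * v * (v + (k + 1 : ℕ) * s)) * (p.1 + S p.2) ^ 2) joint :=
      i₃.const_mul _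
    simp only [id] at e₁
    rw [integral_add (integrable_const _) ((j₃.sub' j₁).sub' j₂), integral_sub (j₃.sub' j₁) j₂,
      integral_sub j₃ j₁, integral_const, integral_const_mul, integral_const_mul, integral_const_mul, e₁, e₂, e₃]
    simp only [probReal_univ, one_smul]
    push_cast
    field_simp
    ring
  exact hfin
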